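/- arXiv:2507.17104 — 2 statements merged into one kernel-verified Lean document; each statement's English description precedes it below -/
import Mathlib

section
/- Let H₀ be a complex Hilbert space, let C be a C*-subalgebra of the algebra B(H₀) of bounded operators on H₀, and let X be a closed linear subspace of B(H₀) such that c∘x ∈ X for all c ∈ C and x ∈ X. Then the closed linear span of {c∘x : c ∈ C, x ∈ X} equals X if and only if for every complex Hilbert space H and every unital *-homomorphism Φ : B(H₀) → B(H), the closed linear span of {Φ(c)(Φ(x)h) : c ∈ C, x ∈ X, h ∈ H} equals the closed linear span of {Φ(x)h : x ∈ X, h ∈ H}. -/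
section CStarAlgebra

variable {A : Type*} [CStarAlgebra A] [PartialOrder A] [StarOrderedRing A]

open scoped ComplexOrder in
/-- If every positive functional vanishing on `C` vanishes on the self-adjoint element `b`, then
`b` is dominated, up to an arbitrarily small multiple of the unit, by a self-adjoint element
of `C`. -/
lemma exists_isSelfAdjoint_mem_le_add_algebraMap (C : NonUnitalStarSubalgebra ℂ A) {b : A}
    (hb : IsSelfAdjoint b)
    (h : ∀ φ : A →ₚ[ℂ] ℂ, (∀ c ∈ C, φ c = 0) → φ b = 0) {ε : ℝ} (hε : 0 < ε) :
    ∃ c ∈ C, IsSelfAdjoint c ∧ b ≤ c + algebraMap ℝ A ε := by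
  set K : Set A := {a | ∃ c ∈ C, a + star a ≤ c + star c}
  have hsmul : ∀ (r : ℝ), 0 ≤ r → ∀ a ∈ K, r • a ∈ K := by
    rintro r hr a ⟨c, hc, hac⟩
    refine ⟨(r : ℂ) • c, SMulMemClass.smul_mem _ hc, ?_⟩
    simpa [← smul_add] using smul_le_smul_of_nonneg_left hac hr
  have hadd : ∀ a ∈ K, ∀ a' ∈ K, a + a' ∈ K := by
    rintro a ⟨c, hc, hac⟩ a' ⟨c', hc', hac'⟩
    refine ⟨c + c', C.add_mem hc hc', ?_⟩
    have := add_le_add hac hac'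
    rw [star_add, star_add]
    convert this using 1 <;> abel
  have hzero : (0 : A) ∈ K := ⟨0, C.zero_mem, le_rfl⟩
  have hconv : Convex ℝ K := fun a ha a' ha' s t hs ht _ ↦
    hadd _ (hsmul s hs a ha) _ (hsmul t ht a' ha')
  have hbK : b ∈ closure K := by
    by_contra hbK
    obtain ⟨f, u, hfu, hub⟩ := RCLike.geometric_hahn_banach_closed_point (𝕜 := ℂ)
      hconv.closure isClosed_closure hbK
    have hu : 0 < u := by simpa using hfu 0 (subset_closure hzero)
    have hneg : ∀ a ∈ K, (f a).re ≤ 0 := by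
      intro a ha
      by_contra! hpos
      have := hfu _ (subset_closure (hsmul (u / (f a).re) (by positivity) a ha))
      rw [← Complex.coe_smul, map_smul] at this
      simp [hpos.ne'] at this
    have hC : ∀ c ∈ C, f c = 0 := by
      intro c hc
      have key : ∀ z : ℂ, (z * f c).re ≤ 0 := fun z ↦ by
        simpa using hneg (z • c) ⟨z • c, SMulMemClass.smul_mem z hc, le_rfl⟩
      have h1 := key 1
      have h2 := key (-1)
      have h3 := key Complex.I
      have h4 := key (-Complex.I)
      simp at h1 h2 h3 h4
      exact Complex.ext (by simpa using le_antisymm h1 h2) (by simpa using le_antisymm h4 h3)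
    have hpos : ∀ p : A, 0 ≤ p → 0 ≤ f p := by
      intro p hp
      have hps : star p = p := (IsSelfAdjoint.of_nonneg hp).star_eq
      have h1 := hneg (-p) ⟨0, C.zero_mem, by
        simpa [hps] using (neg_nonpos.2 hp).trans hp⟩
      have h2 := hneg (Complex.I • p) ⟨0, C.zero_mem, by simp [hps]⟩
      have h3 := hneg (-(Complex.I • p)) ⟨0, C.zero_mem, by simp [hps]⟩
      simp at h1 h2 h3
      exact Complex.nonneg_iff.2 ⟨h1, le_antisymm h2 h3⟩
    have hfb := h (PositiveLinearMap.mk₀ (f : A →ₗ[ℂ] ℂ) hpos) hC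
    have hfb' : f b = 0 := hfb
    simp [hfb'] at hub
    exact lt_asymm hu hub
  obtain ⟨a, ⟨c, hc, hac⟩, hba⟩ := Metric.mem_closure_iff.1 hbK ε hε
  refine ⟨(2⁻¹ : ℂ) • (c + star c), SMulMemClass.smul_mem _ (add_mem hc (star_mem hc)), ?_, ?_⟩
  · simp [IsSelfAdjoint, add_comm]
  have hsa : IsSelfAdjoint ((2⁻¹ : ℝ) • ((b - a) + star (b - a))) := by
    simp [IsSelfAdjoint, add_comm]
  have hnorm : ‖(2⁻¹ : ℝ) • ((b - a) + star (b - a))‖ ≤ ε := by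
    rw [dist_eq_norm] at hba
    have := norm_add_le (b - a) (star (b - a))
    rw [norm_star] at this
    rw [norm_smul, Real.norm_of_nonneg (by norm_num)]
    linarith
  have h1 : (2⁻¹ : ℝ) • ((b - a) + star (b - a)) ≤ algebraMap ℝ A ε :=
    hsa.le_algebraMap_norm_self.trans (algebraMap_mono A hnorm)
  have h2 := smul_le_smul_of_nonneg_left hac (show (0 : ℝ) ≤ 2⁻¹ by norm_num)
  have h3 : b = (2⁻¹ : ℝ) • (a + star a) + (2⁻¹ : ℝ) • ((b - a) + star (b - a)) := by
    rw [star_sub, hb.star_eq]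
    module
  have h4 : (2⁻¹ : ℂ) • (c + star c) = (2⁻¹ : ℝ) • (c + star c) := by
    rw [← Complex.coe_smul]; simp
  rw [h4]
  calc b = _ := h3
    _ ≤ _ := add_le_add h2 h1

/-- If `x * star x` is dominated by `c + ε` with `c` self-adjoint in the closed star subalgebra
`C`, then some element of `C` is, up to `√(2 * ε)`, a left unit for `x`. -/
lemma exists_mem_norm_sub_mul_sq_le (C : NonUnitalStarSubalgebra ℂ A) (hC : IsClosed (C : Set A))
    {x c : A} (hc : c ∈ C) (hcs : IsSelfAdjoint c) {ε : ℝ} (hε : 0 < ε)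
    (hx : x * star x ≤ c + algebraMap ℝ A ε) :
    ∃ u ∈ C, ‖x - u * x‖ ^ 2 ≤ 2 * ε := by
  set f : ℝ → ℝ := fun t ↦ min 1 (|t| / ε) with hf
  have hfc : Continuous f := by fun_prop
  have hf0 : f 0 = 0 := by simp [hf]
  refine ⟨cfcₙ f c, ?_, ?_⟩
  · exact cfcₙ_mem (𝕜' := ℂ) (hs := hC) f hc
  set g : ℝ → ℝ := fun t ↦ 1 - f t with hg
  have hgc : Continuous g := by fun_prop
  have hgu : cfc g c = 1 - cfcₙ f c := by
    rw [cfcₙ_eq_cfc hfc.continuousOn hf0, hg, cfc_sub .., cfc_const_one ℝ c]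
  have hgs : IsSelfAdjoint (cfc g c) := cfc_predicate g c
  have hmid : cfc g c * (c + algebraMap ℝ A ε) * cfc g c =
      cfc (fun t ↦ g t * (t + ε) * g t) c := by
    rw [cfc_mul (fun t ↦ g t * (t + ε)) g c (by fun_prop) (by fun_prop),
      cfc_mul g (fun t ↦ t + ε) c (by fun_prop) (by fun_prop),
      cfc_add_const ε (fun t ↦ t) c (by fun_prop), cfc_id' ℝ c]
  have hle : cfc g c * (x * star x) * cfc g c ≤ algebraMap ℝ A (2 * ε) := by
    refine (hgs.conjugate_le_conjugate hx).trans ?_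
    rw [hmid]
    refine cfc_le_algebraMap _ _ _ fun t _ ↦ ?_
    have hg0 : 0 ≤ g t := by simp [hg, hf]
    have hg1 : g t ≤ 1 := by
      have : 0 ≤ f t := by positivity
      simp only [hg]; linarith
    rcases le_total t ε with ht | ht
    · have : g t * g t ≤ 1 := by nlinarith
      nlinarith [mul_nonneg hg0 hg0]
    · have : f t = 1 := min_eq_left (by
        rw [le_div_iff₀ hε, one_mul]; exact ht.trans (le_abs_self t))
      simp only [hg, this]; nlinarith
  have hmul : x - cfcₙ f c * x = cfc g c * x := by rw [hgu, sub_mul, one_mul]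
  have hstar : cfc g c * (x * star x) * cfc g c = (cfc g c * x) * star (cfc g c * x) := by
    rw [star_mul, hgs.star_eq]; simp only [mul_assoc]
  rw [hmul, sq, ← CStarRing.norm_self_mul_star, ← hstar]
  refine (CStarAlgebra.norm_le_iff_le_algebraMap _ (by positivity) ?_).2 hle
  rw [hstar]; exact mul_star_self_nonneg _

end CStarAlgebra

open scoped ComplexOrder in
/-- If `x` maps the GNS space of a positive functional `φ` vanishing on `C` into the essential
subspace of `C`, then `φ (x * star x) = 0`. -/
lemma PositiveLinearMap.map_mul_star_self_eq_zero {A : Type*} [CStarAlgebra A] [PartialOrder A]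
    [StarOrderedRing A] (φ : A →ₚ[ℂ] ℂ) (C : NonUnitalStarSubalgebra ℂ A)
    (hφ : ∀ c ∈ C, φ c = 0) {x : A}
    (hx : ∀ v, φ.gnsStarAlgHom x v ∈ (Submodule.span ℂ
      {w : φ.GNS | ∃ c ∈ C, ∃ v, w = φ.gnsStarAlgHom c v}).topologicalClosure) :
    φ (x * star x) = 0 := by
  set ξ : φ.GNS := ((φ.toPreGNS 1 : φ.PreGNS) : φ.GNS)
  have hξ : ∀ a, φ.gnsStarAlgHom a ξ = ((φ.toPreGNS a : φ.PreGNS) : φ.GNS) := by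
    intro a
    simp [ξ]
  have hC : ∀ c ∈ C, φ.gnsStarAlgHom c ξ = 0 := by
    intro c hc
    rw [hξ, ← norm_eq_zero, UniformSpace.Completion.norm_coe, PositiveLinearMap.preGNS_norm_def]
    simp [hφ _ (mul_mem (star_mem hc) hc)]
  have hle : (Submodule.span ℂ
      {w : φ.GNS | ∃ c ∈ C, ∃ v, w = φ.gnsStarAlgHom c v}).topologicalClosure ≤ (ℂ ∙ ξ)ᗮ := by
    refine Submodule.topologicalClosure_minimal _ (Submodule.span_le.2 ?_)
      (Submodule.isClosed_orthogonal _)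
    rintro _ ⟨c, hc, v, rfl⟩
    rw [SetLike.mem_coe, Submodule.mem_orthogonal_singleton_iff_inner_right,
      ← ContinuousLinearMap.adjoint_inner_left, ← ContinuousLinearMap.star_eq_adjoint,
      ← map_star, hC _ (star_mem hc), inner_zero_left]
  have := Submodule.mem_orthogonal_singleton_iff_inner_right.1
    (hle (hx (φ.gnsStarAlgHom (star x) ξ)))
  rw [← mul_apply_eq_comp, ← map_mul, hξ, UniformSpace.Completion.inner_coe,
    PositiveLinearMap.preGNS_inner_def] at this
  simpa using this


/-- For a C*-subalgebra `C` of `B(H₀)` and a closed subspace `X ⊆ B(H₀)` with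
`C ∘ X ⊆ X`, the closed linear span of `C ∘ X` equals `X` iff for every Hilbert space `H` and
every unital *-homomorphism `Φ : B(H₀) → B(H)`, the closed linear span of
`{Φ(c)(Φ(x)h)}` equals the closed linear span of `{Φ(x)h}`. -/
theorem nondegenerate_iff_spatially_nondegenerate
    {H₀ : Type u} [NormedAddCommGroup H₀] [InnerProductSpace ℂ H₀] [CompleteSpace H₀]
    (C : NonUnitalStarSubalgebra ℂ (H₀ →L[ℂ] H₀)) (hC : IsClosed (C : Set (H₀ →L[ℂ] H₀)))
    (X : Submodule ℂ (H₀ →L[ℂ] H₀)) (hX : IsClosed (X : Set (H₀ →L[ℂ] H₀)))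
    (hCX : ∀ c ∈ C, ∀ x ∈ X, c * x ∈ X) :
    (Submodule.span ℂ {y : H₀ →L[ℂ] H₀ | ∃ c ∈ C, ∃ x ∈ X, y = c * x}).topologicalClosure = X ↔
      ∀ (H : Type u) [NormedAddCommGroup H] [InnerProductSpace ℂ H] [CompleteSpace H]
        (Φ : (H₀ →L[ℂ] H₀) →⋆ₐ[ℂ] (H →L[ℂ] H)),
        (Submodule.span ℂ
            {v : H | ∃ c ∈ C, ∃ x ∈ X, ∃ h : H, v = Φ c (Φ x h)}).topologicalClosure =
          (Submodule.span ℂ {v : H | ∃ x ∈ X, ∃ h : H, v = Φ x h}).topologicalClosure := by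

  constructor
  · intro h H _ _ _ Φ
    apply le_antisymm
    · refine Submodule.topologicalClosure_mono (Submodule.span_mono ?_)
      rintro _ ⟨c, hc, x, hx, v, rfl⟩
      exact ⟨c * x, hCX c hc x hx, v, by simp⟩
    · refine Submodule.topologicalClosure_minimal _ (Submodule.span_le.2 ?_)
        (Submodule.isClosed_topologicalClosure _)
      rintro _ ⟨x, hx, v, rfl⟩
      set M := (Submodule.span ℂ
        {v : H | ∃ c ∈ C, ∃ x ∈ X, ∃ h : H, v = Φ c (Φ x h)}).topologicalClosure
      have hΦ : Continuous fun a ↦ Φ a v :=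
        (map_continuous Φ).clm_apply continuous_const
      let L : (H₀ →L[ℂ] H₀) →ₗ[ℂ] H :=
        { toFun := fun a ↦ Φ a v
          map_add' := by simp
          map_smul' := by simp }
      have hle : (Submodule.span ℂ
          {y : H₀ →L[ℂ] H₀ | ∃ c ∈ C, ∃ x ∈ X, y = c * x}).topologicalClosure ≤ M.comap L := by
        refine Submodule.topologicalClosure_minimal _ (Submodule.span_le.2 ?_)
          ((Submodule.isClosed_topologicalClosure _).preimage hΦ)
        rintro _ ⟨c, hc, x, hx, rfl⟩
        exact Submodule.le_topologicalClosure _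
          (Submodule.subset_span ⟨c, hc, x, hx, v, by simp [L]⟩)
      rw [h] at hle
      exact hle hx
  · intro h
    apply le_antisymm
    · refine Submodule.topologicalClosure_minimal _ (Submodule.span_le.2 ?_) hX
      rintro _ ⟨c, hc, x, hx, rfl⟩
      exact hCX c hc x hx
    · intro x hx
      refine Metric.mem_closure_iff.2 fun δ hδ ↦ ?_
      have hε : 0 < δ ^ 2 / 4 := by positivity
      obtain ⟨c, hc, hcs, hxc⟩ := exists_isSelfAdjoint_mem_le_add_algebraMap C
        (IsSelfAdjoint.mul_star_self x) (fun φ hφ ↦ φ.map_mul_star_self_eq_zero C hφ fun v ↦ by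
          have hv : φ.gnsStarAlgHom x v ∈ (Submodule.span ℂ {w : φ.GNS | ∃ x ∈ X, ∃ v : φ.GNS,
              w = φ.gnsStarAlgHom x v}).topologicalClosure :=
            Submodule.le_topologicalClosure _ (Submodule.subset_span ⟨x, hx, v, rfl⟩)
          rw [← h φ.GNS φ.gnsStarAlgHom] at hv
          refine Submodule.topologicalClosure_mono (Submodule.span_mono ?_) hv
          rintro _ ⟨c, hc, x, hx, v, rfl⟩
          exact ⟨c, hc, _, rfl⟩) hε
      obtain ⟨u, hu, hux⟩ := exists_mem_norm_sub_mul_sq_le C hC hc hcs hε hxc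
      refine ⟨u * x, Submodule.subset_span ⟨u, hu, x, hx, rfl⟩, ?_⟩
      rw [dist_eq_norm]
      exact lt_of_pow_lt_pow_left₀ 2 hδ.le (hux.trans_lt (by linarith))
end

section
/- Let H₀ be a complex Hilbert space, let C be a C*-subalgebra of B(H₀), and let X be a closed linear subspace of B(H₀) such that c∘x ∈ X for all c ∈ C and x ∈ X. If the closed linear span of {c∘x : c ∈ C, x ∈ X} is a proper subspace of X, then there exist a complex Hilbert space H and a unital *-homomorphism Φ : B(H₀) → B(H) such that the closed linear span of {Φ(c)(Φ(x)h) : c ∈ C, x ∈ X, h ∈ H} is a proper subspace of the closed linear span of {Φ(x)h : x ∈ X, h ∈ H}. -/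
open Filter Topology
open scoped ComplexOrder

/-- Vector functionals of a bounded family of vectors converge along an ultrafilter to a
positive functional. -/
theorem exists_positiveLinearMap_tendsto_inner {ι H : Type*} [NormedAddCommGroup H]
    [InnerProductSpace ℂ H] [CompleteSpace H] (U : Ultrafilter ι) (ξ : ι → H)
    (hξ : ∀ i, ‖ξ i‖ ≤ 1) :
    ∃ f : (H →L[ℂ] H) →ₚ[ℂ] ℂ,
      ∀ a, Tendsto (fun i ↦ inner ℂ (ξ i) (a (ξ i))) U (𝓝 (f a)) := by
  have hlim (a : H →L[ℂ] H) : ∃ z : ℂ, Tendsto (fun i ↦ inner ℂ (ξ i) (a (ξ i))) U (𝓝 z) := by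
    have hbd (i : ι) : inner ℂ (ξ i) (a (ξ i)) ∈ Metric.closedBall (0 : ℂ) ‖a‖ := by
      rw [mem_closedBall_zero_iff]
      calc ‖inner ℂ (ξ i) (a (ξ i))‖ ≤ ‖ξ i‖ * ‖a (ξ i)‖ := norm_inner_le_norm _ _
        _ ≤ 1 * ‖a‖ := by
          gcongr
          · exact hξ i
          · exact a.unit_le_opNorm _ (hξ i)
        _ = ‖a‖ := one_mul _
    obtain ⟨z, -, hz⟩ := (isCompact_closedBall (0 : ℂ) ‖a‖).ultrafilter_le_nhds
      (U.map fun i ↦ inner ℂ (ξ i) (a (ξ i)))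
      (le_principal_iff.2 (Eventually.of_forall (f := (U : Filter ι)) hbd))
    exact ⟨z, hz⟩
  choose φ hφ using hlim
  refine ⟨.mk₀ { toFun := φ, map_add' := fun a b ↦ ?_, map_smul' := fun r a ↦ ?_ }
    fun a ha ↦ ?_, hφ⟩
  · refine tendsto_nhds_unique (hφ (a + b)) ?_
    simpa [inner_add_right] using (hφ a).add (hφ b)
  · refine tendsto_nhds_unique (hφ (r • a)) ?_
    simpa [inner_smul_right] using (hφ a).const_mul r
  · refine isClosed_Ici.mem_of_tendsto (hφ a) (Eventually.of_forall fun i ↦ ?_)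
    exact ((ContinuousLinearMap.nonneg_iff_isPositive a).1 ha).inner_nonneg_right (ξ i)

/-- A C*-subalgebra has a contractive left approximate unit, seen as a filter on the ambient
algebra. -/
theorem NonUnitalStarSubalgebra.exists_approximateUnit {A : Type*} [CStarAlgebra A]
    (C : NonUnitalStarSubalgebra ℂ A) (hC : IsClosed (C : Set A)) :
    ∃ l : Filter A, l.NeBot ∧ (∀ᶠ e in l, e ∈ C ∧ ‖e‖ ≤ 1) ∧
      ∀ c ∈ C, Tendsto (fun e ↦ e * c) l (𝓝 c) := by
  have : CompleteSpace C := hC.completeSpace_coe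
  let _ : NonUnitalCStarAlgebra C := { }
  let _ : PartialOrder C := CStarAlgebra.spectralOrder C
  have : StarOrderedRing C := CStarAlgebra.spectralOrderedRing C
  have hl := CStarAlgebra.increasingApproximateUnit C
  have := hl.neBot
  refine ⟨(CStarAlgebra.approximateUnit C).map (Subtype.val : C → A), inferInstance, ?_, ?_⟩
  · exact eventually_map.2 (hl.eventually_norm.mono fun e he ↦ ⟨e.2, he⟩)
  · intro c hc
    exact tendsto_map'_iff.2
      ((continuous_subtype_val.tendsto _).comp (hl.tendsto_mul_right ⟨c, hc⟩))

/-- The elements on which a filter of left multipliers converges pointwise to the identity. -/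
def leftUnitSubmodule {A : Type*} [NormedRing A] [NormedAlgebra ℂ A] (l : Filter A) :
    Submodule ℂ A where
  carrier := {y | Tendsto (fun e ↦ e * y) l (𝓝 y)}
  add_mem' ha hb := by simpa [mul_add] using Tendsto.add ha hb
  zero_mem' := by simpa using tendsto_const_nhds
  smul_mem' r a ha := by simpa using Tendsto.const_smul ha r

theorem mul_mem_leftUnitSubmodule {A : Type*} [NormedRing A] [NormedAlgebra ℂ A]
    {l : Filter A} {c : A} (hc : Tendsto (fun e ↦ e * c) l (𝓝 c)) (a : A) :
    c * a ∈ leftUnitSubmodule l := by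
  change Tendsto (fun e ↦ e * (c * a)) l (𝓝 (c * a))
  simpa [mul_assoc] using hc.mul_const a

theorem PositiveLinearMap.le_norm_toPreGNS {ι H : Type*} [NormedAddCommGroup H]
    [InnerProductSpace ℂ H] [CompleteSpace H] {l : Filter ι} [l.NeBot] {ξ : ι → H}
    {f : (H →L[ℂ] H) →ₚ[ℂ] ℂ}
    (hf : ∀ a, Tendsto (fun i ↦ inner ℂ (ξ i) (a (ξ i))) l (𝓝 (f a)))
    {a : H →L[ℂ] H} {r : ℝ} (hr : 0 ≤ r) (ha : ∀ᶠ i in l, r ≤ ‖a (ξ i)‖) :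
    r ≤ ‖f.toPreGNS a‖ := by
  rw [f.preGNS_norm_def]
  refine Real.le_sqrt_of_sq_le ?_
  refine ge_of_tendsto ((Complex.continuous_re.tendsto _).comp (hf (star a * a))) ?_
  filter_upwards [ha] with i hi
  have h : inner ℂ (ξ i) ((star a * a) (ξ i)) = ((‖a (ξ i)‖ ^ 2 : ℝ) : ℂ) := by
    rw [ContinuousLinearMap.star_eq_adjoint, mul_apply_eq_comp,
      ContinuousLinearMap.adjoint_inner_right, inner_self_eq_norm_sq_to_K]
    norm_cast
  rw [Function.comp_apply, h, Complex.ofReal_re]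
  gcongr

/-- If `e * x` stays away from `x` along `l`, some positive functional separates `x` in its GNS
seminorm from all elements on which `l` is a left approximate unit. -/
theorem exists_positiveLinearMap_le_norm_toPreGNS_sub {H : Type*} [NormedAddCommGroup H]
    [InnerProductSpace ℂ H] [CompleteSpace H] {l : Filter (H →L[ℂ] H)} [l.NeBot]
    (hl : ∀ᶠ e in l, ‖e‖ ≤ 1) {x : H →L[ℂ] H} {δ : ℝ} (hδ : 0 < δ)
    (hx : ∀ᶠ e in l, δ ≤ ‖x - e * x‖) :
    ∃ f : (H →L[ℂ] H) →ₚ[ℂ] ℂ, ∃ r > 0, ∀ y ∈ leftUnitSubmodule l,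
      r ≤ ‖f.toPreGNS (x - y)‖ := by
  have hvec (e : H →L[ℂ] H) :
      ∃ ξ : H, ‖ξ‖ ≤ 1 ∧ (δ ≤ ‖x - e * x‖ → δ / 2 ≤ ‖(x - e * x) ξ‖) := by
    by_cases he : δ ≤ ‖x - e * x‖
    · obtain ⟨ξ, hξ, h⟩ := (x - e * x).exists_lt_apply_of_lt_opNorm
        ((half_lt_self hδ).trans_le he)
      exact ⟨ξ, hξ.le, fun _ ↦ h.le⟩
    · exact ⟨0, by simp, fun h ↦ absurd h he⟩
  choose ξ hξ hξx using hvec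
  obtain ⟨f, hf⟩ := exists_positiveLinearMap_tendsto_inner (Ultrafilter.of l) ξ hξ
  refine ⟨f, δ / 8, by positivity, fun y hy ↦
    PositiveLinearMap.le_norm_toPreGNS hf (by positivity) (Ultrafilter.of_le l ?_)⟩
  have hy' : ∀ᶠ e in l, ‖e * y - y‖ < δ / 4 :=
    (tendsto_iff_norm_sub_tendsto_zero.1 hy).eventually_lt_const (by positivity)
  filter_upwards [hl, hx, hy'] with e he hex hey
  have h₁ : (x - e * x) (ξ e) =
      (x - y) (ξ e) - e ((x - y) (ξ e)) - (e * y - y) (ξ e) := by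
    simp only [sub_apply, mul_apply_eq_comp, map_sub]
    abel
  have h₂ : ‖e ((x - y) (ξ e))‖ ≤ ‖(x - y) (ξ e)‖ :=
    e.le_of_opNorm_le_of_le he le_rfl |>.trans_eq (one_mul _)
  have h₃ : ‖(e * y - y) (ξ e)‖ ≤ ‖e * y - y‖ := (e * y - y).unit_le_opNorm _ (hξ e)
  have h₄ := hξx e hex
  rw [h₁] at h₄
  have h₅ := norm_sub_le ((x - y) (ξ e) - e ((x - y) (ξ e))) ((e * y - y) (ξ e))
  have h₆ := norm_sub_le ((x - y) (ξ e)) (e ((x - y) (ξ e)))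
  linarith


/-- If the C*-subalgebra `C` of `B(H₀)` acts degenerately on the closed
`C`-invariant subspace `X ⊆ B(H₀)`, then there is a Hilbert space `H` and a unital
*-homomorphism `Φ : B(H₀) → B(H)` witnessing spatial degeneracy. -/
theorem degenerate_action_spatially_degenerate
    {H₀ : Type u} [NormedAddCommGroup H₀] [InnerProductSpace ℂ H₀] [CompleteSpace H₀]
    (C : NonUnitalStarSubalgebra ℂ (H₀ →L[ℂ] H₀)) (hC : IsClosed (C : Set (H₀ →L[ℂ] H₀)))
    (X : Submodule ℂ (H₀ →L[ℂ] H₀)) (hX : IsClosed (X : Set (H₀ →L[ℂ] H₀)))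
    (hCX : ∀ c ∈ C, ∀ x ∈ X, c * x ∈ X)
    (hdeg : (Submodule.span ℂ
        {y : H₀ →L[ℂ] H₀ | ∃ c ∈ C, ∃ x ∈ X, y = c * x}).topologicalClosure < X) :
    ∃ (H : Type u) (_ : NormedAddCommGroup H) (_ : InnerProductSpace ℂ H) (_ : CompleteSpace H)
      (Φ : (H₀ →L[ℂ] H₀) →⋆ₐ[ℂ] (H →L[ℂ] H)),
      (Submodule.span ℂ
          {v : H | ∃ c ∈ C, ∃ x ∈ X, ∃ h : H, v = Φ c (Φ x h)}).topologicalClosure <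
        (Submodule.span ℂ {v : H | ∃ x ∈ X, ∃ h : H, v = Φ x h}).topologicalClosure := by
  obtain ⟨-, x, hxX, hxY⟩ := SetLike.lt_iff_le_and_exists.1 hdeg
  set Y := (Submodule.span ℂ
    {y : H₀ →L[ℂ] H₀ | ∃ c ∈ C, ∃ x ∈ X, y = c * x}).topologicalClosure
  obtain ⟨l, _, hlC, hl⟩ := C.exists_approximateUnit hC
  have hδ : 0 < Metric.infDist x (Y : Set (H₀ →L[ℂ] H₀)) :=
    ((Submodule.isClosed_topologicalClosure _).notMem_iff_infDist_pos ⟨0, Y.zero_mem⟩).1 hxY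
  have hx : ∀ᶠ e in l, Metric.infDist x (Y : Set (H₀ →L[ℂ] H₀)) ≤ ‖x - e * x‖ := by
    filter_upwards [hlC] with e he
    rw [← dist_eq_norm]
    exact Metric.infDist_le_dist_of_mem
      (Submodule.le_topologicalClosure _ (Submodule.subset_span ⟨e, he.1, x, hxX, rfl⟩))
  obtain ⟨f, r, hr, hf⟩ :=
    exists_positiveLinearMap_le_norm_toPreGNS_sub (hlC.mono fun _ h ↦ h.2) hδ hx
  refine ⟨f.GNS, inferInstance, inferInstance, inferInstance, f.gnsStarAlgHom, ?_⟩
  refine SetLike.lt_iff_le_and_exists.2 ⟨?_, ((f.toPreGNS x : f.PreGNS) : f.GNS), ?_, ?_⟩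
  · refine Submodule.topologicalClosure_mono (Submodule.span_mono ?_)
    rintro _ ⟨c, hc, y, hy, h, rfl⟩
    exact ⟨c * y, hCX c hc y hy, h, by rw [map_mul, mul_apply_eq_comp]⟩
  · refine Submodule.le_topologicalClosure _ (Submodule.subset_span ⟨x, hxX,
      ((f.toPreGNS 1 : f.PreGNS) : f.GNS), ?_⟩)
    simp
  · let N : Submodule ℂ f.GNS := (leftUnitSubmodule l).map
      ((UniformSpace.Completion.toComplL (𝕜 := ℂ) (E := f.PreGNS)).toLinearMap ∘ₗ
        f.toPreGNS.toLinearMap)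
    have hN : (Submodule.span ℂ {v : f.GNS | ∃ c ∈ C, ∃ x ∈ X, ∃ h : f.GNS,
        v = f.gnsStarAlgHom c (f.gnsStarAlgHom x h)}).topologicalClosure ≤
        N.topologicalClosure := by
      refine Submodule.topologicalClosure_minimal _ (Submodule.span_le.2 ?_)
        (Submodule.isClosed_topologicalClosure _)
      rintro _ ⟨c, hc, y, -, h, rfl⟩
      induction h using UniformSpace.Completion.induction_on with
      | hp =>
        exact (Submodule.isClosed_topologicalClosure N).preimage
          ((f.gnsStarAlgHom c).continuous.comp (f.gnsStarAlgHom y).continuous)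
      | ih a =>
        refine Submodule.le_topologicalClosure _ ⟨c * (y * f.ofPreGNS a),
          mul_mem_leftUnitSubmodule (hl c hc) _, ?_⟩
        simp
    intro hmem
    obtain ⟨_, ⟨y, hy, rfl⟩, hlt⟩ := Metric.mem_closure_iff.1 (hN hmem) r hr
    refine (hf y hy).not_gt ?_
    rw [map_sub, ← dist_eq_norm, ← UniformSpace.Completion.dist_eq]
    exact hlt
end
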